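/- If c is an odd prime, then for positive integers a, b, the equation a^x + b^y = c^z has at most 2 solutions in positive integers (x, y, z). -/

import Mathlib

def FG (u v : ℤ) : ℕ → ℤ × ℤ
  | 0 => (1, 1)
  | m + 1 => ((u - v) * (FG u v m).1 - 2 * v * (FG u v m).2,
      (u - v) * (FG u v m).2 + 2 * u * (FG u v m).1)

theorem FG_norm (u v : ℤ) (m : ℕ) :
    u * (FG u v m).1 ^ 2 + v * (FG u v m).2 ^ 2 = (u + v) ^ (2 * m + 1) := by
  induction m with
  | zero => simp [FG]
  | succ m ih =>
    have : (u + v) ^ (2 * (m + 1) + 1) = (u + v) ^ 2 * (u + v) ^ (2 * m + 1) := by ring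
    rw [this, ← ih]
    simp only [FG]
    ring

theorem FG_symm (u v : ℤ) (m : ℕ) :
    (FG v u m).1 = (-1) ^ m * (FG u v m).2 ∧ (FG v u m).2 = (-1) ^ m * (FG u v m).1 := by
  induction m with
  | zero => simp [FG]
  | succ m ih =>
    simp only [FG, ih.1, ih.2]
    constructor <;> ring

theorem FG_mod (u v : ℤ) (m : ℕ) :
    (∃ h, (FG u v m).1 = (2 * m + 1) * (-v) ^ m + u * h) ∧
    (∃ h, (FG u v m).2 = (-v) ^ m + u * h) := by
  induction m with
  | zero => exact ⟨⟨0, by simp [FG]⟩, ⟨0, by simp [FG]⟩⟩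
  | succ m ih =>
    obtain ⟨⟨h1, e1⟩, ⟨h2, e2⟩⟩ := ih
    refine ⟨⟨(FG u v m).1 - v * h1 - 2 * v * h2, ?_⟩, ⟨(FG u v m).2 + 2 * (FG u v m).1 - v * h2, ?_⟩⟩
    · simp only [FG]
      push_cast
      linear_combination (-v) * e1 - 2 * v * e2
    · simp only [FG]
      linear_combination (-v) * e2

theorem FG_mod2 (u v : ℤ) (m : ℕ) :
    (∃ h, 3 * (-v) * (FG u v m).1 = 3 * (2 * m + 1) * (-v) ^ (m + 1)
        + m * (2 * m - 1) * (2 * m + 1) * u * (-v) ^ m + u ^ 2 * h) ∧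
    (∃ h, 3 * (-v) * (FG u v m).2 = 3 * (-v) ^ (m + 1)
        + 3 * m * (2 * m + 1) * u * (-v) ^ m + u ^ 2 * h) := by
  induction m with
  | zero => exact ⟨⟨0, by simp [FG]⟩, ⟨0, by simp [FG]⟩⟩
  | succ m ih =>
    obtain ⟨⟨h1, e1⟩, ⟨h2, e2⟩⟩ := ih
    refine ⟨⟨m * (2 * m - 1) * (2 * m + 1) * (-v) ^ m + (u - v) * h1 - 2 * v * h2, ?_⟩,
      ⟨3 * m * (2 * m + 1) * (-v) ^ m + (u - v) * h2 + 2 * (m * (2 * m - 1) * (2 * m + 1) * (-v) ^ m) + 2 * u * h1, ?_⟩⟩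
    · simp only [FG]
      push_cast
      linear_combination (u - v) * e1 - 2 * v * e2
    · simp only [FG]
      push_cast
      linear_combination (u - v) * e2 + 2 * u * e1

theorem FG_pow (X Y : ℝ) (u v : ℤ) (hX : X ^ 2 = u) (hY : Y ^ 2 = v) (m : ℕ) :
    ((X : ℂ) + Y * Complex.I) ^ (2 * m + 1) =
      ((X * (FG u v m).1 : ℝ) : ℂ) + ((Y * (FG u v m).2 : ℝ) : ℂ) * Complex.I := by
  have hX' : (X : ℂ) ^ 2 = u := by exact_mod_cast congrArg (Complex.ofReal) hX
  have hY' : (Y : ℂ) ^ 2 = v := by exact_mod_cast congrArg (Complex.ofReal) hY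
  induction m with
  | zero => simp [FG]
  | succ m ih =>
    have : ((X : ℂ) + Y * Complex.I) ^ (2 * (m + 1) + 1) =
      ((X : ℂ) + Y * Complex.I) ^ 2 * ((X : ℂ) + Y * Complex.I) ^ (2 * m + 1) := by ring
    rw [this, ih]
    simp only [FG]
    push_cast
    rw [← hX', ← hY']
    have hI : Complex.I ^ 2 = -1 := Complex.I_sq
    generalize ((FG u v m).1 : ℂ) = f
    generalize ((FG u v m).2 : ℂ) = g
    generalize (X : ℂ) = x
    generalize (Y : ℂ) = y
    linear_combination (y ^ 2 * x * f + 2 * x * y ^ 2 * g + y ^ 3 * g * Complex.I) * hI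

theorem FG_comp (u v : ℤ) (hu : 0 < u) (hv : 0 < v) (m l : ℕ) :
    (FG u v (2 * m * l + m + l)).1 =
      (FG u v m).1 * (FG (u * (FG u v m).1 ^ 2) (v * (FG u v m).2 ^ 2) l).1 ∧
    (FG u v (2 * m * l + m + l)).2 =
      (FG u v m).2 * (FG (u * (FG u v m).1 ^ 2) (v * (FG u v m).2 ^ 2) l).2 := by
  have hu' : (0 : ℝ) < u := by exact_mod_cast hu
  have hv' : (0 : ℝ) < v := by exact_mod_cast hv
  have hX : (√(u : ℝ)) ^ 2 = u := Real.sq_sqrt hu'.le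
  have hY : (√(v : ℝ)) ^ 2 = v := Real.sq_sqrt hv'.le
  have hX0 : √(u : ℝ) ≠ 0 := (Real.sqrt_pos.2 hu').ne'
  have hY0 : √(v : ℝ) ≠ 0 := (Real.sqrt_pos.2 hv').ne'
  have h1 := FG_pow _ _ u v hX hY m
  have h2 := FG_pow _ _ u v hX hY (2 * m * l + m + l)
  have h3 := FG_pow (√(u : ℝ) * (FG u v m).1) (√(v : ℝ) * (FG u v m).2)
    (u * (FG u v m).1 ^ 2) (v * (FG u v m).2 ^ 2)
    (by push_cast; rw [mul_pow, hX]) (by push_cast; rw [mul_pow, hY]) l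
  rw [← h1, ← pow_mul, show (2 * m + 1) * (2 * l + 1) = 2 * (2 * m * l + m + l) + 1 by ring, h2] at h3
  have hre := congrArg Complex.re h3
  have him := congrArg Complex.im h3
  simp only [Complex.add_re, Complex.add_im, Complex.ofReal_re, Complex.ofReal_im, Complex.mul_re,
    Complex.mul_im, Complex.I_re, Complex.I_im, mul_zero, mul_one, sub_zero, add_zero,
    zero_add] at hre him
  constructor
  · have h := mul_left_cancel₀ hX0 (hre.trans (mul_assoc _ _ _))
    exact_mod_cast h
  · have h := mul_left_cancel₀ hY0 (him.trans (mul_assoc _ _ _))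
    exact_mod_cast h

/-- For a prime `q ≥ 5`, the cofactor is at most `q`. -/
theorem FG_bound (u v : ℤ) (huv : IsCoprime u v) (m : ℕ) (hq : (2 * m + 1).Prime) (h5 : 5 ≤ 2 * m + 1)
    (hf : ∀ p : ℕ, p.Prime → (p : ℤ) ∣ (FG u v m).1 → (p : ℤ) ∣ u) :
    (FG u v m).1 ^ 2 ≤ (2 * m + 1) ^ 2 := by
  have hnv : ∀ p : ℕ, p.Prime → (p : ℤ) ∣ u → ¬ (p : ℤ) ∣ v := by
    intro p hp h1 h2
    exact (Nat.prime_iff_prime_int.1 hp).not_isUnit (huv.isUnit_of_dvd' h1 h2)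
  have key : ∀ p : ℕ, p.Prime → (p : ℤ) ∣ (FG u v m).1 → p = 2 * m + 1 := by
    intro p hp h
    have hu := hf p hp h
    obtain ⟨⟨k, e⟩, -⟩ := FG_mod u v m
    have : (p : ℤ) ∣ (2 * m + 1) * (-v) ^ m := by
      have h' : (p : ℤ) ∣ (FG u v m).1 - u * k := dvd_sub h (hu.mul_right _)
      rwa [e, add_sub_cancel_right] at h'
    have hpp := Nat.prime_iff_prime_int.1 hp
    rcases hpp.dvd_or_dvd this with h | h
    · have : p ∣ 2 * m + 1 := by exact_mod_cast h
      exact (Nat.prime_dvd_prime_iff_eq hp hq).1 this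
    · exact absurd ((dvd_neg).1 (hpp.dvd_of_dvd_pow h)) (hnv p hp hu)
  have hsq : ¬ ((2 * m + 1 : ℕ) : ℤ) ^ 2 ∣ (FG u v m).1 := by
    intro h
    have hu := hf _ hq ((dvd_pow_self _ two_ne_zero).trans h)
    have hv := hnv _ hq hu
    obtain ⟨⟨k, e⟩, -⟩ := FG_mod2 u v m
    obtain ⟨w, hw⟩ := hu
    have hqq := Nat.prime_iff_prime_int.1 hq
    have : ((2 * m + 1 : ℕ) : ℤ) ^ 2 ∣ ((2 * m + 1 : ℕ) : ℤ) * (3 * (-v) ^ (m + 1)) := by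
      have e' : ((2 * m + 1 : ℕ) : ℤ) * (3 * (-v) ^ (m + 1)) = 3 * (-v) * (FG u v m).1
        - ((2 * m + 1 : ℕ) : ℤ) ^ 2 * (m * (2 * m - 1) * w * (-v) ^ m + w ^ 2 * k) := by
        rw [e, hw]; push_cast; ring
      rw [e']
      exact dvd_sub (h.mul_left _) (dvd_mul_right _ _)
    rw [sq] at this
    have := (mul_dvd_mul_iff_left hqq.ne_zero).1 this
    rcases hqq.dvd_or_dvd this with h | h
    · have : 2 * m + 1 ∣ 3 := by exact_mod_cast h
      have := Nat.le_of_dvd (by norm_num) this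
      omega
    · exact hv ((dvd_neg).1 (hqq.dvd_of_dvd_pow h))
  have h0 : (FG u v m).1.natAbs ≠ 0 := by
    intro h
    exact hsq (by rw [Int.natAbs_eq_zero.1 h]; exact dvd_zero _)
  have hpow := Nat.eq_prime_pow_of_unique_prime_dvd (n := (FG u v m).1.natAbs) (p := 2 * m + 1) h0
    (fun {d} hd h => key d hd (Int.natCast_dvd.2 h))
  have hlt : (FG u v m).1.natAbs.primeFactorsList.length < 2 := by
    by_contra hcon
    apply hsq
    have : (2 * m + 1) ^ 2 ∣ (FG u v m).1.natAbs := by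
      rw [hpow]; exact pow_dvd_pow _ (by omega)
    exact_mod_cast Int.natCast_dvd.2 this
  have hle : (FG u v m).1.natAbs ≤ 2 * m + 1 := by
    rw [hpow]
    calc (2 * m + 1) ^ _ ≤ (2 * m + 1) ^ 1 := Nat.pow_le_pow_right (by omega) (by omega)
      _ = _ := pow_one _
  rw [← Int.natAbs_sq]
  have : ((FG u v m).1.natAbs : ℤ) ≤ 2 * m + 1 := by exact_mod_cast hle
  nlinarith [Int.natCast_nonneg (FG u v m).1.natAbs]

theorem three_pow_gt (m : ℕ) (hm : 2 ≤ m) : (2 * m + 1) ^ 2 < 3 ^ (2 * m) := by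
  induction m, hm using Nat.le_induction with
  | base => norm_num
  | succ m hm ih =>
    have : 3 ^ (2 * (m + 1)) = 9 * 3 ^ (2 * m) := by ring
    nlinarith

theorem no_big_prime (u v : ℤ) (hu : 0 < u) (hv : 0 < v) (h3 : 3 ≤ u + v) (huv : IsCoprime u v) (m : ℕ)
    (hq : (2 * m + 1).Prime) (h5 : 5 ≤ 2 * m + 1)
    (hf : ∀ p : ℕ, p.Prime → (p : ℤ) ∣ (FG u v m).1 → (p : ℤ) ∣ u)
    (hg : ∀ p : ℕ, p.Prime → (p : ℤ) ∣ (FG u v m).2 → (p : ℤ) ∣ v) : False := by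
  have b1 := FG_bound u v huv m hq h5 hf
  have b2 := FG_bound v u huv.symm m hq h5 (by
    intro p hp h
    apply hg p hp
    rw [(FG_symm u v m).1] at h
    exact (IsUnit.dvd_mul_left (by exact (isUnit_one.neg).pow m)).1 h)
  rw [(FG_symm u v m).1, mul_pow, ← pow_mul, mul_comm m 2, pow_mul] at b2
  norm_num at b2
  have hN := FG_norm u v m
  have h4 : (3 : ℤ) ^ (2 * m) ≤ (u + v) ^ (2 * m) := pow_le_pow_left₀ (by norm_num) h3 _
  have h6 : ((2 * m + 1 : ℤ)) ^ 2 < 3 ^ (2 * m) := by exact_mod_cast three_pow_gt m (by omega)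
  rw [pow_succ (u + v)] at hN
  have h7 : (u + v) * (2 * m + 1 : ℤ) ^ 2 < (u + v) * (u + v) ^ (2 * m) :=
    mul_lt_mul_of_pos_left (by omega) (by omega)
  have h8 := mul_le_mul_of_nonneg_left b1 hu.le
  have h9 := mul_le_mul_of_nonneg_left b2 hv.le
  linarith

def Exc (u v : ℤ) : Prop := v = 3 * u + 1 ∧ ∃ i : ℕ, 8 * u + 3 = 3 ^ i

theorem pow3_of {w : ℤ} (h : ∀ p : ℕ, p.Prime → (p : ℤ) ∣ w → p = 3) : ∃ i : ℕ, w = 3 ^ i ∨ w = - 3 ^ i := by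
  have h0 : w.natAbs ≠ 0 := by
    intro h0
    have := h 2 Nat.prime_two (by rw [Int.natAbs_eq_zero.1 h0]; exact dvd_zero _)
    omega
  have hpow := Nat.eq_prime_pow_of_unique_prime_dvd (n := w.natAbs) (p := 3) h0
    (fun {d} hd h' => h d hd (Int.natCast_dvd.2 h'))
  generalize w.natAbs.primeFactorsList.length = i at hpow
  refine ⟨i, ?_⟩
  rcases Int.natAbs_eq w with e | e
  · left; rw [e, hpow]; push_cast; rfl
  · right; rw [e, hpow]; push_cast; rfl

theorem pow3_mod (i : ℕ) : (3 : ℤ) ^ i % 8 = 1 ∨ (3 : ℤ) ^ i % 8 = 3 := by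
  induction i with
  | zero => simp
  | succ i ih => rw [pow_succ]; omega

theorem exc_aux (u v : ℤ) (hu : 0 < u) (hv : 0 < v)
    (i : ℕ) (h1 : u - 3 * v = 3 ^ i ∨ u - 3 * v = - 3 ^ i)
    (h2 : 3 * u - v = 1 ∨ 3 * u - v = -1) : Exc u v := by
  have hp : (0 : ℤ) < 3 ^ i := by positivity
  have := pow3_mod i
  rcases h1 with h1 | h1 <;> rcases h2 with h2 | h2
  · omega
  · omega
  · exfalso
    have h8 : 8 * u - 3 = 3 ^ i := by omega
    omega
  · exact ⟨by omega, i, by omega⟩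

theorem exc_three (u v : ℤ) (hu : 0 < u) (hv : 0 < v) (huv : IsCoprime u v)
    (hf : ∀ p : ℕ, p.Prime → (p : ℤ) ∣ u - 3 * v → (p : ℤ) ∣ u)
    (hg : ∀ p : ℕ, p.Prime → (p : ℤ) ∣ 3 * u - v → (p : ℤ) ∣ v) : Exc u v ∨ Exc v u := by
  have aux : ∀ u v : ℤ, IsCoprime u v → (∀ p : ℕ, p.Prime → (p : ℤ) ∣ u - 3 * v → (p : ℤ) ∣ u) →
      ∀ p : ℕ, p.Prime → (p : ℤ) ∣ u - 3 * v → p = 3 := by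
    intro u v huv hf p hp h
    have h1 := hf p hp h
    have hpp := Nat.prime_iff_prime_int.1 hp
    have h2 : (p : ℤ) ∣ 3 * v := by simpa using dvd_sub h1 h
    rcases hpp.dvd_or_dvd h2 with h3 | h3
    · exact (Nat.prime_dvd_prime_iff_eq hp Nat.prime_three).1 (by exact_mod_cast h3)
    · exact absurd (huv.isUnit_of_dvd' h1 h3) hpp.not_isUnit
  have hg' : ∀ p : ℕ, p.Prime → (p : ℤ) ∣ v - 3 * u → (p : ℤ) ∣ v := by
    intro p hp h
    exact hg p hp (by rw [← dvd_neg]; simpa using h)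
  have a1 := aux u v huv hf
  have a2 := aux v u huv.symm hg'
  obtain ⟨i, hi⟩ := pow3_of a1
  obtain ⟨j, hj⟩ := pow3_of a2
  rcases Nat.eq_zero_or_pos i with rfl | hi0
  · right
    exact exc_aux v u hv hu j hj (by simp at hi; omega)
  rcases Nat.eq_zero_or_pos j with rfl | hj0
  · left
    exact exc_aux u v hu hv i hi (by simp at hj; omega)
  exfalso
  have d1 : (3 : ℤ) ∣ u := by
    have : (3 : ℤ) ∣ 3 ^ i := dvd_pow_self _ hi0.ne'
    omega
  have d2 : (3 : ℤ) ∣ v := by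
    have : (3 : ℤ) ∣ 3 ^ j := dvd_pow_self _ hj0.ne'
    omega
  exact Int.prime_three.not_isUnit (huv.isUnit_of_dvd' d1 d2)

theorem Exc.dvd {u v : ℤ} (h : Exc u v) (hu : 0 < u) : (3 : ℤ) ∣ u := by
  obtain ⟨-, i, hi⟩ := h
  have : i ≠ 0 := by rintro rfl; simp at hi; omega
  have : (3 : ℤ) ∣ 3 ^ i := dvd_pow_self _ this
  omega

theorem FG_zero (u v : ℤ) : FG u v 0 = (1, 1) := rfl

theorem FG_one (u v : ℤ) : FG u v 1 = (u - 3 * v, 3 * u - v) := by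
  simp only [FG]; ext <;> simp <;> ring

/-- first step: some odd prime dividing the exponent is 3 -/
theorem exc_step (u v : ℤ) (hu : 0 < u) (hv : 0 < v) (h3 : 3 ≤ u + v) (huv : IsCoprime u v) (m : ℕ) (hm : m ≠ 0)
    (hf : ∀ p : ℕ, p.Prime → (p : ℤ) ∣ (FG u v m).1 → (p : ℤ) ∣ u)
    (hg : ∀ p : ℕ, p.Prime → (p : ℤ) ∣ (FG u v m).2 → (p : ℤ) ∣ v) :
    (Exc u v ∨ Exc v u) ∧ ∃ l, m = 2 * 1 * l + 1 + l := by
  obtain ⟨q, hq, k, hk⟩ := Nat.exists_prime_and_dvd (n := 2 * m + 1) (by omega)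
  have hqo : Odd q := by
    have : Odd (q * k) := hk ▸ odd_two_mul_add_one m
    exact (Nat.odd_mul.1 this).1
  have hko : Odd k := by
    have : Odd (q * k) := hk ▸ odd_two_mul_add_one m
    exact (Nat.odd_mul.1 this).2
  obtain ⟨r, rfl⟩ := hqo
  obtain ⟨l, rfl⟩ := hko
  have hml : m = 2 * r * l + r + l := by
    have : 2 * m + 1 = 2 * (2 * r * l + r + l) + 1 := by rw [hk]; ring
    omega
  obtain ⟨c1, c2⟩ := FG_comp u v hu hv r l
  rw [← hml] at c1 c2
  have hf' : ∀ p : ℕ, p.Prime → (p : ℤ) ∣ (FG u v r).1 → (p : ℤ) ∣ u :=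
    fun p hp h => hf p hp (by rw [c1]; exact h.mul_right _)
  have hg' : ∀ p : ℕ, p.Prime → (p : ℤ) ∣ (FG u v r).2 → (p : ℤ) ∣ v :=
    fun p hp h => hg p hp (by rw [c2]; exact h.mul_right _)
  by_cases h5 : 5 ≤ 2 * r + 1
  · exact (no_big_prime u v hu hv h3 huv r hq h5 hf' hg').elim
  · have : r ≠ 0 := by rintro rfl; exact Nat.not_prime_one hq
    have : r = 1 := by omega
    subst this
    rw [FG_one] at hf' hg'
    exact ⟨exc_three u v hu hv huv hf' hg', l, hml⟩

theorem exc_final_aux (u v : ℤ) (hu : 0 < u) (hv : 0 < v) (h3 : 3 ≤ u + v) (huv : IsCoprime u v) (m : ℕ) (hm : m ≠ 0)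
    (hf : ∀ p : ℕ, p.Prime → (p : ℤ) ∣ (FG u v m).1 → (p : ℤ) ∣ u)
    (hg : ∀ p : ℕ, p.Prime → (p : ℤ) ∣ (FG u v m).2 → (p : ℤ) ∣ v) (he : Exc u v) : m = 1 := by
  obtain ⟨-, l, hl⟩ := exc_step u v hu hv h3 huv m hm hf hg
  by_cases hl0 : l = 0
  · omega
  exfalso
  obtain ⟨c1, c2⟩ := FG_comp u v hu hv 1 l
  rw [← hl] at c1 c2
  have d3 := he.dvd hu
  obtain ⟨hv3, i, hi⟩ := he
  have g1 : (FG u v 1).2 = -1 := by rw [FG_one]; simp; omega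
  have f1 : (FG u v 1).1 = - 3 ^ i := by rw [FG_one]; simp; omega
  rw [g1, f1] at c1 c2
  have hsq : v * (-1) ^ 2 = v := by ring
  rw [hsq] at c1 c2
  set u' := u * (-3 ^ i) ^ 2 with hu'
  have hp : (1 : ℤ) < 3 ^ i := by omega
  have hlt : u < u' := by rw [hu']; nlinarith
  have hcop : IsCoprime u' v := by
    rw [hu']
    refine IsCoprime.mul_left huv ?_
    apply IsCoprime.pow_left
    apply IsCoprime.neg_left
    apply IsCoprime.pow_left
    exact huv.of_isCoprime_of_dvd_left d3
  have := (exc_step u' v (by omega) hv (by omega) hcop l hl0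
    (fun p hp h => (hf p hp (by rw [c1]; exact h.mul_left _)).mul_right _)
    (fun p hp h => (hg p hp (by rw [c2]; exact h.mul_left _)))).1
  rcases this with h | h
  · have := h.1; omega
  · have := h.dvd hv; omega

theorem exc_final (u v : ℤ) (hu : 0 < u) (hv : 0 < v) (h3 : 3 ≤ u + v) (huv : IsCoprime u v) (m : ℕ) (hm : m ≠ 0)
    (hf : ∀ p : ℕ, p.Prime → (p : ℤ) ∣ (FG u v m).1 → (p : ℤ) ∣ u)
    (hg : ∀ p : ℕ, p.Prime → (p : ℤ) ∣ (FG u v m).2 → (p : ℤ) ∣ v) : m = 1 ∧ (Exc u v ∨ Exc v u) := by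
  have h := (exc_step u v hu hv h3 huv m hm hf hg).1
  refine ⟨?_, h⟩
  have hun : IsUnit ((-1 : ℤ) ^ m) := (isUnit_one.neg).pow m
  rcases h with h | h
  · exact exc_final_aux u v hu hv h3 huv m hm hf hg h
  · refine exc_final_aux v u hv hu (by omega) huv.symm m hm ?_ ?_ h
    · intro p hp h
      rw [(FG_symm u v m).1, hun.dvd_mul_left] at h
      exact hg p hp h
    · intro p hp h
      rw [(FG_symm u v m).2, hun.dvd_mul_left] at h
      exact hf p hp h

section VarB

structure Ctx (a b c s t : ℤ) : Prop where
  hc : Prime c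
  hc2 : ¬ c ∣ 2
  hca : ¬ c ∣ a
  hcb : ¬ c ∣ b
  hcs : ¬ c ∣ s
  hct : ¬ c ∣ t
  hs : 0 < s
  ht : 0 < t
  pa : ∃ p, Prime p ∧ p ∣ a
  pb : ∃ p, Prime p ∧ p ∣ b

structure Gam (a b c s t P Q : ℤ) (n : ℕ) : Prop where
  eq : s * P ^ 2 + t * Q ^ 2 = c ^ n
  hP : ¬ c ∣ P
  hQ : ¬ c ∣ Q
  ra : ∀ p, Prime p → p ∣ a → p ∣ s * P
  rb : ∀ p, Prime p → p ∣ b → p ∣ t * Q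

variable {a b c s t : ℤ}

theorem Ctx.pos (X : Ctx a b c s t) {P Q : ℤ} {n : ℕ} (eq : s * P ^ 2 + t * Q ^ 2 = c ^ n)
    (ra : ∀ p, Prime p → p ∣ a → p ∣ s * P) (rb : ∀ p, Prime p → p ∣ b → p ∣ t * Q) : n ≠ 0 := by
  rintro rfl
  rw [pow_zero] at eq
  have hs := X.hs
  have ht := X.ht
  by_cases hP : P = 0
  · subst hP
    obtain ⟨p, hp, h⟩ := X.pb
    have h1 := (rb p hp h).mul_right Q
    rw [show t * Q * Q = 1 by linarith] at h1
    exact hp.not_isUnit (isUnit_of_dvd_one h1)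
  by_cases hQ : Q = 0
  · subst hQ
    obtain ⟨p, hp, h⟩ := X.pa
    have h1 := (ra p hp h).mul_right P
    rw [show s * P * P = 1 by linarith] at h1
    exact hp.not_isUnit (isUnit_of_dvd_one h1)
  have h1 : 0 < P ^ 2 := by positivity
  have h2 : 0 < Q ^ 2 := by positivity
  nlinarith

theorem Ctx.both (X : Ctx a b c s t) {P Q : ℤ} {n : ℕ} (eq : s * P ^ 2 + t * Q ^ 2 = c ^ n)
    (hn : n ≠ 0) : c ∣ P ↔ c ∣ Q := by
  have h0 : c ∣ s * P ^ 2 + t * Q ^ 2 := eq ▸ dvd_pow_self _ hn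
  constructor
  · intro h
    have h1 : c ∣ t * Q ^ 2 := (dvd_add_right ((dvd_pow h two_ne_zero).mul_left s)).1 h0
    exact X.hc.dvd_of_dvd_pow ((X.hc.dvd_or_dvd h1).resolve_left X.hct)
  · intro h
    have h1 : c ∣ s * P ^ 2 := (dvd_add_left ((dvd_pow h two_ne_zero).mul_left t)).1 h0
    exact X.hc.dvd_of_dvd_pow ((X.hc.dvd_or_dvd h1).resolve_left X.hcs)

theorem Ctx.not_dvd (X : Ctx a b c s t) {p : ℤ} (hp : Prime p) (h : p ∣ a ∨ p ∣ b) : ¬ p ∣ c := by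
  intro hd
  have := (hp.dvd_prime_iff_associated X.hc).1 hd
  rcases h with h | h
  · exact X.hca (this.symm.dvd.trans h)
  · exact X.hcb (this.symm.dvd.trans h)

theorem Ctx.step (X : Ctx a b c s t) {P1 Q1 P2 Q2 : ℤ} {n1 n2 : ℕ} (G1 : Gam a b c s t P1 Q1 n1)
    (G2 : Gam a b c s t P2 Q2 n2) (hn : n1 < n2) (hd : c ^ n1 ∣ P1 * Q2 - P2 * Q1) :
    ∃ P3 Q3 n3, Gam a b c s t P3 Q3 n3 ∧ (n3 < n1 ∨ (n2 = n3 + 2 * n1 ∧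
      P2 = P3 * (s * P1 ^ 2 - t * Q1 ^ 2) - Q3 * (2 * P1 * Q1) * t ∧
      Q2 = Q3 * (s * P1 ^ 2 - t * Q1 ^ 2) + P3 * (2 * P1 * Q1) * s)) := by
  obtain ⟨d, rfl⟩ := Nat.exists_eq_add_of_lt hn
  set D := d + 1 with hD
  have hnd : n1 + d + 1 = n1 + D := by omega
  rw [hnd] at *
  obtain ⟨F, hF⟩ := hd
  have hc0 : c ≠ 0 := X.hc.ne_zero
  have hC0 : c ^ n1 ≠ 0 := pow_ne_zero _ hc0
  have e1 := G1.eq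
  have e2 := G2.eq
  have hE : c ^ n1 ∣ s * P1 * P2 + t * Q1 * Q2 := by
    rw [← Int.pow_dvd_pow_iff (two_ne_zero)]
    refine ⟨c ^ D - s * t * F ^ 2, ?_⟩
    have : (s * P1 * P2 + t * Q1 * Q2) ^ 2 + s * t * (P1 * Q2 - P2 * Q1) ^ 2
      = (s * P1 ^ 2 + t * Q1 ^ 2) * (s * P2 ^ 2 + t * Q2 ^ 2) := by ring
    rw [hF, e1, e2, pow_add] at this
    linear_combination this
  obtain ⟨E, hE⟩ := hE
  have hN : E ^ 2 + s * t * F ^ 2 = c ^ D := by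
    apply mul_left_cancel₀ (pow_ne_zero 2 hC0)
    have : (s * P1 * P2 + t * Q1 * Q2) ^ 2 + s * t * (P1 * Q2 - P2 * Q1) ^ 2
      = (s * P1 ^ 2 + t * Q1 ^ 2) * (s * P2 ^ 2 + t * Q2 ^ 2) := by ring
    rw [hF, hE, e1, e2, pow_add] at this
    linear_combination this
  have hP2 : P2 = E * P1 - t * F * Q1 := by
    apply mul_left_cancel₀ hC0
    linear_combination (-P2) * e1 + P1 * hE - t * Q1 * hF
  have hQ2 : Q2 = E * Q1 + s * F * P1 := by
    apply mul_left_cancel₀ hC0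
    linear_combination (-Q2) * e1 + Q1 * hE + s * P1 * hF
  -- the common part
  have main : ∀ m e : ℕ, m ≤ n1 → m ≤ D → n1 + D = e + 2 * m → ∃ P3 Q3,
      E * P1 + t * F * Q1 = c ^ m * P3 ∧ s * F * P1 - E * Q1 = c ^ m * Q3 ∧
      s * P3 ^ 2 + t * Q3 ^ 2 = c ^ e ∧ (∀ p, Prime p → p ∣ a → p ∣ s * P3) ∧
      (∀ p, Prime p → p ∣ b → p ∣ t * Q3) := by
    intro m e hm1 hm2 hme
    have d1 : c ^ m ∣ c ^ n1 := pow_dvd_pow _ hm1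
    have d2 : c ^ m ∣ c ^ D := pow_dvd_pow _ hm2
    have hA : c ^ m ∣ E * P1 + t * F * Q1 := by
      apply X.hc.pow_dvd_of_dvd_mul_left m G2.hP
      have : P2 * (E * P1 + t * F * Q1) = c ^ D * P1 ^ 2 - c ^ n1 * (t * F ^ 2) := by
        rw [hP2]; linear_combination P1 ^ 2 * hN - t * F ^ 2 * e1
      rw [this]
      exact dvd_sub (d2.mul_right _) (d1.mul_right _)
    have hB : c ^ m ∣ s * F * P1 - E * Q1 := by
      apply X.hc.pow_dvd_of_dvd_mul_left m G2.hQ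
      have : Q2 * (s * F * P1 - E * Q1) = c ^ n1 * (s * F ^ 2) - c ^ D * Q1 ^ 2 := by
        rw [hQ2]; linear_combination s * F ^ 2 * e1 - Q1 ^ 2 * hN
      rw [this]
      exact dvd_sub (d1.mul_right _) (d2.mul_right _)
    obtain ⟨P3, hP3⟩ := hA
    obtain ⟨Q3, hQ3⟩ := hB
    refine ⟨P3, Q3, hP3, hQ3, ?_, ?_, ?_⟩
    · apply mul_left_cancel₀ (pow_ne_zero 2 (pow_ne_zero m hc0))
      have h1 : (c ^ m) ^ 2 * c ^ e = c ^ n1 * c ^ D := by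
        rw [← pow_add, hme, ← pow_mul, ← pow_add]; congr 1; ring
      rw [h1, ← hN, ← e1]
      have : (c ^ m) ^ 2 * (s * P3 ^ 2 + t * Q3 ^ 2) = s * (c ^ m * P3) ^ 2 + t * (c ^ m * Q3) ^ 2 := by
        ring
      rw [this, ← hP3, ← hQ3]
      ring
    · intro p hp h
      have h1 := G1.ra p hp h
      have h2 := G2.ra p hp h
      have hpc := X.not_dvd hp (Or.inl h)
      have h3 : p ∣ c ^ m * (c ^ n1 * (s * P3)) := by
        have : c ^ m * (c ^ n1 * (s * P3)) = s * P1 * (c ^ n1 * E) + t * Q1 * (Q2 * (s * P1) - s * P2 * Q1) := by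
          linear_combination (-s) * c ^ n1 * hP3 - s * t * Q1 * hF
        rw [this]
        exact dvd_add (h1.mul_right _) ((dvd_sub (h1.mul_left _) (h2.mul_right _)).mul_left _)
      have h4 := (hp.dvd_or_dvd h3).resolve_left (fun h => hpc (hp.dvd_of_dvd_pow h))
      exact (hp.dvd_or_dvd h4).resolve_left (fun h => hpc (hp.dvd_of_dvd_pow h))
    · intro p hp h
      have h1 := G1.rb p hp h
      have h2 := G2.rb p hp h
      have hpc := X.not_dvd hp (Or.inr h)
      have h3 : p ∣ c ^ m * (c ^ n1 * (t * Q3)) := by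
        have : c ^ m * (c ^ n1 * (t * Q3)) = s * P1 * (P1 * (t * Q2) - P2 * (t * Q1)) - t * Q1 * (c ^ n1 * E) := by
          linear_combination (-t) * c ^ n1 * hQ3 - s * t * P1 * hF
        rw [this]
        exact dvd_sub ((dvd_sub (h2.mul_left _) (h1.mul_left _)).mul_left _) (h1.mul_right _)
      have h4 := (hp.dvd_or_dvd h3).resolve_left (fun h => hpc (hp.dvd_of_dvd_pow h))
      exact (hp.dvd_or_dvd h4).resolve_left (fun h => hpc (hp.dvd_of_dvd_pow h))
  rcases le_or_gt n1 D with hle | hlt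
  · obtain ⟨e, he⟩ := Nat.exists_eq_add_of_le hle
    obtain ⟨P3, Q3, hA, hB, h3, ra, rb⟩ := main n1 e le_rfl hle (by omega)
    have hP2' : P2 = P3 * (s * P1 ^ 2 - t * Q1 ^ 2) - Q3 * (2 * P1 * Q1) * t := by
      apply mul_left_cancel₀ hC0
      rw [hP2]
      linear_combination (s * P1 ^ 2 - t * Q1 ^ 2) * hA - 2 * P1 * Q1 * t * hB
        - (E * P1 - t * F * Q1) * e1
    have hQ2' : Q2 = Q3 * (s * P1 ^ 2 - t * Q1 ^ 2) + P3 * (2 * P1 * Q1) * s := by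
      apply mul_left_cancel₀ hC0
      rw [hQ2]
      linear_combination (s * P1 ^ 2 - t * Q1 ^ 2) * hB + 2 * P1 * Q1 * s * hA
        - (E * Q1 + s * F * P1) * e1
    have hb := X.both h3 (X.pos h3 ra rb)
    have hnb : ¬ (c ∣ P3 ∧ c ∣ Q3) := by
      rintro ⟨h1, h2⟩
      apply G2.hP
      rw [hP2']
      exact dvd_sub (h1.mul_right _) ((h2.mul_right _).mul_right _)
    exact ⟨P3, Q3, e, ⟨h3, fun h => hnb ⟨h, hb.1 h⟩, fun h => hnb ⟨hb.2 h, h⟩, ra, rb⟩,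
      Or.inr ⟨by omega, hP2', hQ2'⟩⟩
  · obtain ⟨e, he⟩ := Nat.exists_eq_add_of_le hlt.le
    obtain ⟨P3, Q3, hA, hB, h3, ra, rb⟩ := main D e hlt.le le_rfl (by omega)
    have hP1' : P1 = E * P3 + t * F * Q3 := by
      apply mul_left_cancel₀ (pow_ne_zero D hc0)
      linear_combination E * hA + t * F * hB - P1 * hN
    have hb := X.both h3 (X.pos h3 ra rb)
    have hnb : ¬ (c ∣ P3 ∧ c ∣ Q3) := by
      rintro ⟨h1, h2⟩
      apply G1.hP
      rw [hP1']
      exact dvd_add (h1.mul_left _) (h2.mul_left _)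
    exact ⟨P3, Q3, e, ⟨h3, fun h => hnb ⟨h, hb.1 h⟩, fun h => hnb ⟨hb.2 h, h⟩, ra, rb⟩,
      Or.inl (by omega)⟩

theorem Ctx.compat (X : Ctx a b c s t) {P1 Q1 P2 Q2 : ℤ} {n1 n2 : ℕ} (G1 : Gam a b c s t P1 Q1 n1)
    (G2 : Gam a b c s t P2 Q2 n2) (hn : n1 ≤ n2) :
    c ^ n1 ∣ P1 * Q2 - P2 * Q1 ∨ c ^ n1 ∣ P1 * Q2 + P2 * Q1 := by
  obtain ⟨d, rfl⟩ := Nat.exists_eq_add_of_le hn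
  have e1 := G1.eq
  have e2 := G2.eq
  have h1 : c ^ n1 ∣ s * ((P1 * Q2 - P2 * Q1) * (P1 * Q2 + P2 * Q1)) := by
    refine ⟨Q2 ^ 2 - c ^ d * Q1 ^ 2, ?_⟩
    rw [pow_add] at e2
    linear_combination Q2 ^ 2 * e1 - Q1 ^ 2 * e2
  have h2 := X.hc.pow_dvd_of_dvd_mul_left n1 X.hcs h1
  by_cases h : c ∣ P1 * Q2 - P2 * Q1
  · left
    refine X.hc.pow_dvd_of_dvd_mul_right n1 ?_ h2
    intro h'
    have h3 := dvd_add h h'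
    rw [show P1 * Q2 - P2 * Q1 + (P1 * Q2 + P2 * Q1) = 2 * (P1 * Q2) by ring] at h3
    rcases X.hc.dvd_or_dvd ((X.hc.dvd_or_dvd h3).resolve_left X.hc2) with h4 | h4
    · exact G1.hP h4
    · exact G2.hQ h4
  · right
    exact X.hc.pow_dvd_of_dvd_mul_left n1 h h2

theorem Gam.coprime (X : Ctx a b c s t) {P Q : ℤ} {n : ℕ} (G : Gam a b c s t P Q n) :
    IsCoprime (s * P ^ 2) (t * Q ^ 2) := by
  rw [Int.isCoprime_iff_gcd_eq_one]
  by_contra h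
  obtain ⟨p, hp, hd⟩ := Nat.exists_prime_and_dvd h
  have hpp := Nat.prime_iff_prime_int.1 hp
  have h1 : (p : ℤ) ∣ s * P ^ 2 := (Int.natCast_dvd_natCast.2 hd).trans (Int.gcd_dvd_left ..)
  have h2 : (p : ℤ) ∣ t * Q ^ 2 := (Int.natCast_dvd_natCast.2 hd).trans (Int.gcd_dvd_right ..)
  have h3 : (p : ℤ) ∣ c ^ n := G.eq ▸ dvd_add h1 h2
  have h4 := (hpp.dvd_prime_iff_associated X.hc).1 (hpp.dvd_of_dvd_pow h3)
  have h5 := h4.symm.dvd.trans h1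
  rcases X.hc.dvd_or_dvd h5 with h6 | h6
  · exact X.hcs h6
  · exact G.hP (X.hc.dvd_of_dvd_pow h6)

theorem Ctx.same (X : Ctx a b c s t) {P1 Q1 P2 Q2 : ℤ} {n1 : ℕ} (G1 : Gam a b c s t P1 Q1 n1)
    (G2 : Gam a b c s t P2 Q2 n1) (hd : c ^ n1 ∣ P1 * Q2 - P2 * Q1) :
    ∃ σ : ℤ, σ ^ 2 = 1 ∧ P2 = σ * P1 ∧ Q2 = σ * Q1 := by
  obtain ⟨F, hF⟩ := hd
  have hc0 : c ≠ 0 := X.hc.ne_zero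
  have hC0 : c ^ n1 ≠ 0 := pow_ne_zero _ hc0
  have e1 := G1.eq
  have e2 := G2.eq
  have hE : c ^ n1 ∣ s * P1 * P2 + t * Q1 * Q2 := by
    rw [← Int.pow_dvd_pow_iff (two_ne_zero)]
    refine ⟨1 - s * t * F ^ 2, ?_⟩
    have : (s * P1 * P2 + t * Q1 * Q2) ^ 2 + s * t * (P1 * Q2 - P2 * Q1) ^ 2
      = (s * P1 ^ 2 + t * Q1 ^ 2) * (s * P2 ^ 2 + t * Q2 ^ 2) := by ring
    rw [hF, e1, e2] at this
    linear_combination this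
  obtain ⟨E, hE⟩ := hE
  have hN : E ^ 2 + s * t * F ^ 2 = 1 := by
    apply mul_left_cancel₀ (pow_ne_zero 2 hC0)
    have : (s * P1 * P2 + t * Q1 * Q2) ^ 2 + s * t * (P1 * Q2 - P2 * Q1) ^ 2
      = (s * P1 ^ 2 + t * Q1 ^ 2) * (s * P2 ^ 2 + t * Q2 ^ 2) := by ring
    rw [hF, hE, e1, e2] at this
    linear_combination this
  have hP2 : P2 = E * P1 - t * F * Q1 := by
    apply mul_left_cancel₀ hC0
    linear_combination (-P2) * e1 + P1 * hE - t * Q1 * hF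
  have hQ2 : Q2 = E * Q1 + s * F * P1 := by
    apply mul_left_cancel₀ hC0
    linear_combination (-Q2) * e1 + Q1 * hE + s * P1 * hF
  have hst : 0 < s * t := mul_pos X.hs X.ht
  by_cases hF0 : F = 0
  · subst hF0
    exact ⟨E, by linarith, by linarith, by linarith⟩
  · exfalso
    have hF2 : 0 < F ^ 2 := by positivity
    have hE0 : E = 0 := by
      have : E ^ 2 ≤ 0 := by nlinarith
      nlinarith [sq_nonneg E]
    subst hE0
    obtain ⟨p, hp, h⟩ := X.pa
    have h1 := G1.ra p hp h
    have h2 : p ∣ t * Q1 * Q2 := by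
      rw [mul_zero] at hE
      have : t * Q1 * Q2 = - (s * P1 * P2) := by linarith
      rw [this]
      exact (h1.mul_right _).neg_right
    have h3 := G2.ra p hp h
    have hcop : ∀ P Q n, Gam a b c s t P Q n → p ∣ s * P → ¬ p ∣ t * Q := by
      intro P Q n G k1 k2
      refine hp.not_isUnit ((Gam.coprime X G).isUnit_of_dvd' ?_ ?_)
      · rw [sq, ← mul_assoc]; exact k1.mul_right _
      · rw [sq, ← mul_assoc]; exact k2.mul_right _
    rcases hp.dvd_or_dvd h2 with h4 | h4
    · exact hcop _ _ _ G1 h1 h4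
    · exact hcop _ _ _ G2 h3 (h4.mul_left _)

theorem Ctx.power (X : Ctx a b c s t) {P1 Q1 : ℤ} {n1 : ℕ} (G1 : Gam a b c s t P1 Q1 n1)
    (hmin : ∀ P Q n, Gam a b c s t P Q n → n1 ≤ n) :
    ∀ n P Q, Gam a b c s t P Q n → c ^ n1 ∣ P1 * Q - P * Q1 →
      ∃ (m : ℕ) (σ : ℤ), σ ^ 2 = 1 ∧ P = σ * P1 * (FG (s * P1 ^ 2) (t * Q1 ^ 2) m).1 ∧
        Q = σ * Q1 * (FG (s * P1 ^ 2) (t * Q1 ^ 2) m).2 := by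
  intro n
  induction n using Nat.strong_induction_on with
  | _ n ih =>
  intro P Q G hd
  have hn1 : n1 ≠ 0 := X.pos G1.eq G1.ra G1.rb
  rcases (hmin _ _ _ G).eq_or_lt with rfl | hlt
  · obtain ⟨σ, h1, h2, h3⟩ := X.same G1 G hd
    exact ⟨0, σ, h1, by simp [FG, h2], by simp [FG, h3]⟩
  obtain ⟨P3, Q3, n3, G3, h⟩ := X.step G1 G hlt hd
  rcases h with h | ⟨h1, h2, h3⟩
  · exact absurd (hmin _ _ _ G3) (by omega)
  rcases X.compat G1 G3 (hmin _ _ _ G3) with hc | hc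
  · obtain ⟨m, σ, k1, k2, k3⟩ := ih n3 (by omega) P3 Q3 G3 hc
    refine ⟨m + 1, σ, k1, ?_, ?_⟩
    · rw [h2]
      simp only [FG]
      rw [k2, k3]
      ring
    · rw [h3]
      simp only [FG]
      rw [k2, k3]
      ring
  · exfalso
    have hcc : c ∣ P1 * Q3 + P3 * Q1 := (dvd_pow_self _ hn1).trans hc
    have hc1 : c ∣ s * P1 ^ 2 + t * Q1 ^ 2 := G1.eq ▸ dvd_pow_self _ hn1
    have : c ∣ Q1 * P := by
      have e : Q1 * P = (P1 * Q3 + P3 * Q1) * (s * P1 ^ 2 - t * Q1 ^ 2)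
          - (P1 * Q3) * (s * P1 ^ 2 + t * Q1 ^ 2) := by
        rw [h2]; ring
      rw [e]
      exact dvd_sub (hcc.mul_right _) (hc1.mul_left _)
    rcases X.hc.dvd_or_dvd this with h | h
    · exact G1.hQ h
    · exact G.hP h

/-- Every element is, up to signs, an odd power of a fixed one. -/
theorem Ctx.exists_base (X : Ctx a b c s t) {P0 Q0 : ℤ} {n0 : ℕ} (G0 : Gam a b c s t P0 Q0 n0) :
    ∃ P1 Q1 n1, Gam a b c s t P1 Q1 n1 ∧ ∀ P Q n, Gam a b c s t P Q n →
      ∃ m : ℕ, P ^ 2 = P1 ^ 2 * (FG (s * P1 ^ 2) (t * Q1 ^ 2) m).1 ^ 2 ∧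
        Q ^ 2 = Q1 ^ 2 * (FG (s * P1 ^ 2) (t * Q1 ^ 2) m).2 ^ 2 := by
  classical
  have hex : ∃ n, ∃ P Q, Gam a b c s t P Q n := ⟨n0, P0, Q0, G0⟩
  obtain ⟨P1, Q1, G1⟩ := Nat.find_spec hex
  have hmin : ∀ P Q n, Gam a b c s t P Q n → Nat.find hex ≤ n :=
    fun P Q n G => Nat.find_min' hex ⟨P, Q, G⟩
  refine ⟨P1, Q1, _, G1, ?_⟩
  intro P Q n G
  rcases X.compat G1 G (hmin _ _ _ G) with h | h
  · obtain ⟨m, σ, h1, h2, h3⟩ := X.power G1 hmin n P Q G h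
    refine ⟨m, ?_, ?_⟩
    · rw [h2, mul_pow, mul_pow, h1]; ring
    · rw [h3, mul_pow, mul_pow, h1]; ring
  · have G' : Gam a b c s t P (-Q) n := ⟨by rw [neg_sq]; exact G.eq, G.hP, by rw [dvd_neg]; exact G.hQ,
      G.ra, fun p hp h => by rw [mul_neg, dvd_neg]; exact G.rb p hp h⟩
    obtain ⟨m, σ, h1, h2, h3⟩ := X.power G1 hmin n P (-Q) G' (by
      rw [show P1 * (-Q) - P * Q1 = -(P1 * Q + P * Q1) by ring, dvd_neg]; exact h)
    refine ⟨m, ?_, ?_⟩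
    · rw [h2, mul_pow, mul_pow, h1]; ring
    · rw [← neg_sq, h3, mul_pow, mul_pow, h1]; ring

end VarB

theorem finish (a b x y x' y' : ℕ) (ha : 2 ≤ a) (hb : 2 ≤ b) (hx : 0 < x) (hy : 0 < y)
    (u v : ℤ) (hu : (a : ℤ) ^ x = u) (hv : (b : ℤ) ^ y = v)
    (hu' : (a : ℤ) ^ x' = u * (u - 3 * v) ^ 2) (hv' : (b : ℤ) ^ y' = v * (3 * u - v) ^ 2)
    (he : Exc u v) : a = 3 ∧ b = 10 ∧ x = 1 ∧ y = 1 ∧ x' = 7 ∧ y' = 1 := by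
  have hu0 : 0 < u := by rw [← hu]; positivity
  have h3u := he.dvd hu0
  obtain ⟨h1, i, hi⟩ := he
  rw [show 3 * u - v = -1 by omega] at hv'
  rw [show u - 3 * v = - 3 ^ i by omega] at hu'
  have hyy : y' = y := by
    apply Nat.pow_right_injective hb
    have : (b : ℤ) ^ y' = (b : ℤ) ^ y := by rw [hv', hv]; ring
    exact_mod_cast this
  have hxn : a ^ x' = a ^ x * 3 ^ (2 * i) := by
    have : (a : ℤ) ^ x' = a ^ x * 3 ^ (2 * i) := by rw [hu', hu]; ring
    exact_mod_cast this
  have hi0 : i ≠ 0 := by rintro rfl; simp at hi; omega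
  have hlt : x < x' := by
    by_contra hle
    have h2 := Nat.pow_le_pow_right (show 0 < a by omega) (not_lt.1 hle)
    have h3 : 1 < 3 ^ (2 * i) := Nat.one_lt_pow (by omega) (by norm_num)
    have h4 : 0 < a ^ x := by positivity
    nlinarith
  obtain ⟨d, rfl⟩ := Nat.exists_eq_add_of_lt hlt
  have hd : a ∣ 3 ^ (2 * i) := by
    have : a ^ x * a ^ (d + 1) = a ^ x * 3 ^ (2 * i) := by rw [← hxn]; ring
    rw [← Nat.eq_of_mul_eq_mul_left (by positivity) this]
    exact dvd_pow_self _ (by omega)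
  obtain ⟨e, -, rfl⟩ := (Nat.dvd_prime_pow Nat.prime_three).1 hd
  have he0 : e ≠ 0 := by rintro rfl; simp at ha
  have hw : u = 3 ^ (e * x) := by rw [← hu]; push_cast; rw [pow_mul]
  have hex : e * x = 1 := by
    by_contra hne
    have hpos : 0 < e * x := by positivity
    have h9 : (9 : ℤ) ∣ u := by
      rw [hw, show (9 : ℤ) = 3 ^ 2 by norm_num]
      exact pow_dvd_pow _ (by omega)
    by_cases hi1 : i = 1
    · subst hi1; omega
    · have : (9 : ℤ) ∣ 3 ^ i := by
        rw [show (9 : ℤ) = 3 ^ 2 by norm_num]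
        exact pow_dvd_pow _ (by omega)
      omega
  obtain rfl : e = 1 := Nat.dvd_one.1 ⟨x, hex.symm⟩
  obtain rfl : x = 1 := by omega
  norm_num at hw
  subst hw
  have hv10 : v = 10 := by omega
  have hby : b ^ y = 10 := by
    have : (b : ℤ) ^ y = 10 := by rw [hv, hv10]
    exact_mod_cast this
  have hy1 : y = 1 := by
    by_contra hne
    have h2 : b ^ 2 ∣ 10 := hby ▸ pow_dvd_pow _ (by omega)
    have h3 : b ≤ 3 := by
      have := Nat.le_of_dvd (by norm_num) h2
      nlinarith
    interval_cases b <;> omega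
  subst hy1
  rw [pow_one] at hby
  refine ⟨rfl, hby, rfl, rfl, ?_, hyy⟩
  have : (3 : ℤ) ^ (1 + d + 1) = 3 ^ 7 := by
    have : (3 : ℤ) ^ i = 27 := by omega
    rw [this] at hu'
    norm_num at hu' ⊢
    exact hu'
  exact Nat.pow_right_injective (le_refl 2 |>.trans (by norm_num : 2 ≤ 3)) (by exact_mod_cast this)

theorem pair_aux (a b c : ℕ) (ha : 2 ≤ a) (hb : 2 ≤ b) (hc : c.Prime) (hodd : Odd c) (hca : ¬ c ∣ a)
    (hcb : ¬ c ∣ b) (x1 y1 z1 x2 y2 z2 : ℕ) (hx1 : 0 < x1) (hy1 : 0 < y1)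
    (hx2 : 0 < x2) (hy2 : 0 < y2) (e1 : a ^ x1 + b ^ y1 = c ^ z1)
    (e2 : a ^ x2 + b ^ y2 = c ^ z2) (hx : x1 % 2 = x2 % 2) (hy : y1 % 2 = y2 % 2)
    (hne : ¬ (x1 = x2 ∧ y1 = y2)) :
    ∃ u v : ℤ, (Exc u v ∨ Exc v u) ∧
     (((a : ℤ) ^ x1 = u ∧ (b : ℤ) ^ y1 = v ∧ (a : ℤ) ^ x2 = u * (u - 3 * v) ^ 2 ∧
        (b : ℤ) ^ y2 = v * (3 * u - v) ^ 2) ∨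
      ((a : ℤ) ^ x2 = u ∧ (b : ℤ) ^ y2 = v ∧ (a : ℤ) ^ x1 = u * (u - 3 * v) ^ 2 ∧
        (b : ℤ) ^ y1 = v * (3 * u - v) ^ 2)) := by
  have hcz := Nat.prime_iff_prime_int.1 hc
  have hc3 : 3 ≤ c := by
    have := hc.two_le
    obtain ⟨k, hk⟩ := hodd
    omega
  have hca' : ¬ (c : ℤ) ∣ a := by exact_mod_cast hca
  have hcb' : ¬ (c : ℤ) ∣ b := by exact_mod_cast hcb
  have prim : ∀ n : ℕ, 2 ≤ n → ∃ p : ℤ, Prime p ∧ p ∣ n := by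
    intro n hn
    obtain ⟨p, hp, hd⟩ := Nat.exists_prime_and_dvd (n := n) (by omega)
    exact ⟨p, Nat.prime_iff_prime_int.1 hp, Int.natCast_dvd_natCast.2 hd⟩
  have X : Ctx a b c ((a : ℤ) ^ (x1 % 2)) ((b : ℤ) ^ (y1 % 2)) :=
    { hc := hcz
      hc2 := by
        intro h
        have : c ∣ 2 := by exact_mod_cast h
        have := Nat.le_of_dvd (by norm_num) this
        omega
      hca := hca'
      hcb := hcb'
      hcs := fun h => hca' (hcz.dvd_of_dvd_pow h)
      hct := fun h => hcb' (hcz.dvd_of_dvd_pow h)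
      hs := by positivity
      ht := by positivity
      pa := prim a ha
      pb := prim b hb }
  have spl : ∀ (n : ℤ) (x k : ℕ), x % 2 = k → n ^ x = n ^ k * (n ^ (x / 2)) ^ 2 := by
    intro n x k h
    rw [← pow_mul, ← pow_add]
    congr 1
    omega
  have mk : ∀ x y z : ℕ, 0 < x → 0 < y → a ^ x + b ^ y = c ^ z → x % 2 = x1 % 2 → y % 2 = y1 % 2 →
      Gam a b c ((a : ℤ) ^ (x1 % 2)) ((b : ℤ) ^ (y1 % 2)) ((a : ℤ) ^ (x / 2)) ((b : ℤ) ^ (y / 2)) z := by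
    intro x y z hx0 hy0 e hx hy
    refine ⟨?_, fun h => hca' (hcz.dvd_of_dvd_pow h), fun h => hcb' (hcz.dvd_of_dvd_pow h), ?_, ?_⟩
    · rw [← spl _ _ _ hx, ← spl _ _ _ hy]; exact_mod_cast e
    · intro p hp h
      rw [← pow_add]
      exact dvd_pow h (by omega)
    · intro p hp h
      rw [← pow_add]
      exact dvd_pow h (by omega)
  have G1 := mk x1 y1 z1 hx1 hy1 e1 rfl rfl
  have G2 := mk x2 y2 z2 hx2 hy2 e2 hx.symm hy.symm
  obtain ⟨P, Q, n, G, hG⟩ := X.exists_base G1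
  obtain ⟨m1, p1, q1⟩ := hG _ _ _ G1
  obtain ⟨m2, p2, q2⟩ := hG _ _ _ G2
  have hcop := Gam.coprime X G
  have hP0 : P ≠ 0 := by rintro rfl; exact G.hP (dvd_zero _)
  have hQ0 : Q ≠ 0 := by rintro rfl; exact G.hQ (dvd_zero _)
  have ras : ∀ p : ℤ, Prime p → p ∣ a → p ∣ (a : ℤ) ^ (x1 % 2) * P ^ 2 := by
    intro p hp h
    rw [sq, ← mul_assoc]; exact (G.ra p hp h).mul_right _
  have rbs : ∀ p : ℤ, Prime p → p ∣ b → p ∣ (b : ℤ) ^ (y1 % 2) * Q ^ 2 := by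
    intro p hp h
    rw [sq, ← mul_assoc]; exact (G.rb p hp h).mul_right _
  have hu0 : 0 < (a : ℤ) ^ (x1 % 2) * P ^ 2 := by positivity
  have hv0 : 0 < (b : ℤ) ^ (y1 % 2) * Q ^ 2 := by positivity
  have h3 : 3 ≤ (a : ℤ) ^ (x1 % 2) * P ^ 2 + (b : ℤ) ^ (y1 % 2) * Q ^ 2 := by
    rw [G.eq]
    have hn : n ≠ 0 := X.pos G.eq G.ra G.rb
    have : c ≤ c ^ n := Nat.le_self_pow hn c
    have : 3 ≤ c ^ n := by omega
    exact_mod_cast this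
  have ea1 := spl a x1 _ rfl
  have eb1 := spl b y1 _ rfl
  have ea2 := spl a x2 _ hx.symm
  have eb2 := spl b y2 _ hy.symm
  rw [p1, ← mul_assoc] at ea1
  rw [q1, ← mul_assoc] at eb1
  rw [p2, ← mul_assoc] at ea2
  rw [q2, ← mul_assoc] at eb2
  generalize (a : ℤ) ^ (x1 % 2) * P ^ 2 = u at *
  generalize (b : ℤ) ^ (y1 % 2) * Q ^ 2 = v at *
  have fin : ∀ (m x y : ℕ), (a : ℤ) ^ x = u * (FG u v m).1 ^ 2 → (b : ℤ) ^ y = v * (FG u v m).2 ^ 2 →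
      m ≠ 0 → m = 1 ∧ (Exc u v ∨ Exc v u) := by
    intro m x y hx hy hm
    refine exc_final u v hu0 hv0 h3 hcop m hm ?_ ?_
    · intro p hp h
      have hpp := Nat.prime_iff_prime_int.1 hp
      refine ras p hpp (hpp.dvd_of_dvd_pow (n := x) ?_)
      rw [hx]; exact (dvd_pow h two_ne_zero).mul_left _
    · intro p hp h
      have hpp := Nat.prime_iff_prime_int.1 hp
      refine rbs p hpp (hpp.dvd_of_dvd_pow (n := y) ?_)
      rw [hy]; exact (dvd_pow h two_ne_zero).mul_left _
  have hm12 : m1 ≠ m2 := by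
    rintro rfl
    apply hne
    constructor
    · apply Nat.pow_right_injective ha
      have : (a : ℤ) ^ x1 = (a : ℤ) ^ x2 := by rw [ea1, ea2]
      exact_mod_cast this
    · apply Nat.pow_right_injective hb
      have : (b : ℤ) ^ y1 = (b : ℤ) ^ y2 := by rw [eb1, eb2]
      exact_mod_cast this
  by_cases hm1 : m1 = 0
  · subst hm1
    obtain ⟨rfl, hE⟩ := fin m2 x2 y2 ea2 eb2 (fun h => hm12 h.symm)
    rw [FG_one] at ea2 eb2
    rw [FG_zero] at ea1 eb1
    exact ⟨u, v, hE, Or.inl ⟨by simpa using ea1, by simpa using eb1, ea2, eb2⟩⟩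
  · obtain ⟨rfl, hE⟩ := fin m1 x1 y1 ea1 eb1 hm1
    have hm2 : m2 = 0 := by
      by_contra hm2
      exact hm12 (fin m2 x2 y2 ea2 eb2 hm2).1.symm
    subst hm2
    rw [FG_one] at ea1 eb1
    rw [FG_zero] at ea2 eb2
    exact ⟨u, v, hE, Or.inr ⟨by simpa using ea2, by simpa using eb2, ea1, eb1⟩⟩

theorem pair_main (a b c : ℕ) (ha : 2 ≤ a) (hb : 2 ≤ b) (hc : c.Prime) (hodd : Odd c) (hca : ¬ c ∣ a)
    (hcb : ¬ c ∣ b) (x1 y1 z1 x2 y2 z2 : ℕ) (hx1 : 0 < x1) (hy1 : 0 < y1) (hz1 : 0 < z1)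
    (hx2 : 0 < x2) (hy2 : 0 < y2) (hz2 : 0 < z2) (e1 : a ^ x1 + b ^ y1 = c ^ z1)
    (e2 : a ^ x2 + b ^ y2 = c ^ z2) (hx : x1 % 2 = x2 % 2) (hy : y1 % 2 = y2 % 2)
    (hne : ¬ (x1 = x2 ∧ y1 = y2)) :
    c = 13 ∧ ((a = 3 ∧ b = 10 ∧ y1 = 1 ∧ y2 = 1 ∧ (x1 = 1 ∧ x2 = 7 ∨ x1 = 7 ∧ x2 = 1)) ∨
      (a = 10 ∧ b = 3 ∧ x1 = 1 ∧ x2 = 1 ∧ (y1 = 1 ∧ y2 = 7 ∨ y1 = 7 ∧ y2 = 1))) := by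
  have c13 : ∀ z, 0 < z → 13 = c ^ z → c = 13 := by
    intro z hz h
    have : c ∣ 13 := h ▸ dvd_pow_self c hz.ne'
    exact (Nat.prime_dvd_prime_iff_eq hc (by norm_num)).1 this
  obtain ⟨u, v, hE, h⟩ := pair_aux a b c ha hb hc hodd hca hcb x1 y1 z1 x2 y2 z2 hx1 hy1 hx2 hy2 e1 e2 hx hy hne
  have sw : ∀ w : ℤ, w * (u - 3 * v) ^ 2 = w * (3 * v - u) ^ 2 := fun w => by ring
  have sw' : ∀ w : ℤ, w * (3 * u - v) ^ 2 = w * (v - 3 * u) ^ 2 := fun w => by ring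
  rcases h with ⟨h1, h2, h3, h4⟩ | ⟨h1, h2, h3, h4⟩ <;> rcases hE with hE | hE
  · obtain ⟨rfl, rfl, rfl, rfl, rfl, rfl⟩ := finish a b x1 y1 x2 y2 ha hb hx1 hy1 u v h1 h2 h3 h4 hE
    exact ⟨c13 z1 hz1 e1, by simp⟩
  · rw [sw] at h3
    rw [sw'] at h4
    obtain ⟨rfl, rfl, rfl, rfl, rfl, rfl⟩ := finish b a y1 x1 y2 x2 hb ha hy1 hx1 v u h2 h1 h4 h3 hE
    exact ⟨c13 z1 hz1 e1, by simp⟩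
  · obtain ⟨rfl, rfl, rfl, rfl, rfl, rfl⟩ := finish a b x2 y2 x1 y1 ha hb hx2 hy2 u v h1 h2 h3 h4 hE
    exact ⟨c13 z2 hz2 e2, by simp⟩
  · rw [sw] at h3
    rw [sw'] at h4
    obtain ⟨rfl, rfl, rfl, rfl, rfl, rfl⟩ := finish b a y2 x2 y1 x1 hb ha hy2 hx2 v u h2 h1 h4 h3 hE
    exact ⟨c13 z2 hz2 e2, by simp⟩

/-- Among three solutions of `i x - j y ≡ h (mod 2 h)`, two agree modulo 2. -/
theorem parity_lin (h : ℕ) : ∀ (i j x1 y1 x2 y2 x3 y3 : ℤ), 0 < h →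
    (2 * h : ℤ) ∣ i * x1 - j * y1 - h → (2 * h : ℤ) ∣ i * x2 - j * y2 - h →
    (2 * h : ℤ) ∣ i * x3 - j * y3 - h →
    (x1 % 2 = x2 % 2 ∧ y1 % 2 = y2 % 2) ∨ (x1 % 2 = x3 % 2 ∧ y1 % 2 = y3 % 2) ∨
    (x2 % 2 = x3 % 2 ∧ y2 % 2 = y3 % 2) := by
  induction h using Nat.strong_induction_on with
  | _ h ih =>
  intro i j x1 y1 x2 y2 x3 y3 h0 d1 d2 d3
  have two : ∀ x y : ℤ, (2 * h : ℤ) ∣ i * x - j * y - h → (i * x - j * y - h) % 2 = 0 := by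
    intro x y d
    exact Int.emod_eq_zero_of_dvd ((dvd_mul_right _ _).trans d)
  have m1 := two _ _ d1
  have m2 := two _ _ d2
  have m3 := two _ _ d3
  by_cases hij : i % 2 = 0 ∧ j % 2 = 0
  · obtain ⟨i', rfl⟩ := Int.dvd_of_emod_eq_zero hij.1
    obtain ⟨j', rfl⟩ := Int.dvd_of_emod_eq_zero hij.2
    have heven : h % 2 = 0 := by
      rw [mul_assoc, mul_assoc] at m1
      omega
    obtain ⟨h', rfl⟩ := Nat.dvd_of_mod_eq_zero heven
    have dd : ∀ x y : ℤ, (2 * (2 * h' : ℕ) : ℤ) ∣ 2 * i' * x - 2 * j' * y - (2 * h' : ℕ) →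
        (2 * h' : ℤ) ∣ i' * x - j' * y - h' := by
      intro x y d
      apply (mul_dvd_mul_iff_left (two_ne_zero (α := ℤ))).1
      push_cast at d
      rw [show 2 * (i' * x - j' * y - (h' : ℤ)) = 2 * i' * x - 2 * j' * y - 2 * h' by ring]
      exact d
    exact ih h' (by omega) i' j' x1 y1 x2 y2 x3 y3 (by omega) (dd _ _ d1) (dd _ _ d2) (dd _ _ d3)
  · have key : ∀ x y : ℤ, (i * x - j * y - h) % 2 = ((i % 2) * (x % 2) - (j % 2) * (y % 2) - (h : ℤ) % 2) % 2 := by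
      intro x y
      simp [Int.sub_emod, Int.mul_emod]
    rw [key] at m1 m2 m3
    rcases Int.emod_two_eq_zero_or_one i with hi | hi <;>
    rcases Int.emod_two_eq_zero_or_one j with hj | hj <;>
    first
      | (simp only [hi, hj] at m1 m2 m3; omega)
      | exact absurd ⟨hi, hj⟩ hij

theorem parity_three (a b c : ℕ) (hc : c.Prime) (hodd : Odd c) (hca : ¬ c ∣ a) (hcb : ¬ c ∣ b)
    (x1 y1 z1 x2 y2 z2 x3 y3 z3 : ℕ) (hz1 : 0 < z1) (hz2 : 0 < z2) (hz3 : 0 < z3)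
    (e1 : a ^ x1 + b ^ y1 = c ^ z1) (e2 : a ^ x2 + b ^ y2 = c ^ z2) (e3 : a ^ x3 + b ^ y3 = c ^ z3) :
    (x1 % 2 = x2 % 2 ∧ y1 % 2 = y2 % 2) ∨ (x1 % 2 = x3 % 2 ∧ y1 % 2 = y3 % 2) ∨
    (x2 % 2 = x3 % 2 ∧ y2 % 2 = y3 % 2) := by
  have : Fact c.Prime := ⟨hc⟩
  have hc2 := hc.two_le
  obtain ⟨h, hh⟩ := hodd
  have h0 : 0 < h := by omega
  have ha0 : (a : ZMod c) ≠ 0 := by rwa [Ne, ZMod.natCast_eq_zero_iff]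
  have hb0 : (b : ZMod c) ≠ 0 := by rwa [Ne, ZMod.natCast_eq_zero_iff]
  obtain ⟨g, hg⟩ := IsCyclic.exists_generator (α := (ZMod c)ˣ)
  obtain ⟨i, hi⟩ := Subgroup.mem_zpowers_iff.1 (hg (Units.mk0 _ ha0))
  obtain ⟨j, hj⟩ := Subgroup.mem_zpowers_iff.1 (hg (Units.mk0 _ hb0))
  have hord : orderOf g = 2 * h := by
    rw [orderOf_eq_card_of_forall_mem_zpowers hg, Nat.card_eq_fintype_card, ZMod.card_units]
    omega
  have hneg : g ^ h = -1 := by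
    have h1 : (g ^ h) ^ 2 = 1 := by rw [← pow_mul, mul_comm, ← hord, pow_orderOf_eq_one]
    have h2 : g ^ h ≠ 1 := by
      intro h3
      have := Nat.le_of_dvd h0 (orderOf_dvd_of_pow_eq_one h3)
      omega
    have h4 : ((g ^ h : (ZMod c)ˣ) : ZMod c) ^ 2 = 1 := by
      rw [← Units.val_pow_eq_pow_val, h1, Units.val_one]
    rw [sq] at h4
    rcases mul_self_eq_one_iff.1 h4 with h | h
    · exact absurd (Units.ext h) h2
    · exact Units.ext (by simpa using h)
  have key : ∀ x y z : ℕ, 0 < z → a ^ x + b ^ y = c ^ z → (2 * h : ℤ) ∣ i * x - j * y - h := by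
    intro x y z hz e
    have e' : (a : ZMod c) ^ x = - (b : ZMod c) ^ y := by
      have := congrArg (Nat.cast : ℕ → ZMod c) e
      push_cast at this
      rw [ZMod.natCast_self, zero_pow hz.ne'] at this
      exact eq_neg_of_add_eq_zero_left this
    have e'' : (Units.mk0 _ ha0) ^ x = g ^ h * (Units.mk0 _ hb0) ^ y := by
      apply Units.ext
      rw [hneg]
      simp [e']
    rw [← hi, ← hj, ← zpow_natCast, ← zpow_natCast, ← zpow_natCast, ← zpow_mul, ← zpow_mul, ← zpow_add] at e''
    have h5 := orderOf_dvd_sub_iff_zpow_eq_zpow.2 e''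
    rw [hord] at h5
    push_cast at h5
    convert h5 using 1
    ring
  have := parity_lin h i j x1 y1 x2 y2 x3 y3 h0 (key _ _ _ hz1 e1) (key _ _ _ hz2 e2) (key _ _ _ hz3 e3)
  omega


theorem pow_period (n M k : ℕ) (h : n ^ k % M = 1 % M) (x : ℕ) : n ^ x % M = n ^ (x % k) % M := by
  conv_lhs => rw [← Nat.mod_add_div x k, pow_add, pow_mul, Nat.mul_mod, Nat.pow_mod (n ^ k), h,
    ← Nat.pow_mod, one_pow, ← Nat.mul_mod, mul_one]

theorem special_parity (x y z : ℕ) (hy : 0 < y) (hz : 0 < z) (e : 3 ^ x + 10 ^ y = 13 ^ z) :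
    x % 2 = 1 ∧ y % 2 = 1 := by
  have h13 : (3 ^ (x % 6) + 10 ^ (y % 6)) % 13 = 0 := by
    rw [Nat.add_mod, ← pow_period 3 13 6 (by norm_num), ← pow_period 10 13 6 (by norm_num),
      ← Nat.add_mod, e]
    exact Nat.mod_eq_zero_of_dvd (dvd_pow_self _ hz.ne')
  have h7 : (3 ^ (x % 6) + 10 ^ (y % 6)) % 7 = 13 ^ (z % 2) % 7 := by
    rw [Nat.add_mod, ← pow_period 3 7 6 (by norm_num), ← pow_period 10 7 6 (by norm_num),
      ← Nat.add_mod, e, pow_period 13 7 2 (by norm_num)]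
  have h8 : (3 ^ (x % 2) + 10 ^ y) % 8 = 13 ^ (z % 2) % 8 := by
    rw [Nat.add_mod, ← pow_period 3 8 2 (by norm_num), ← Nat.add_mod, e,
      pow_period 13 8 2 (by norm_num)]
  have fin : ∀ r : ℕ, r < 6 → ∀ s : ℕ, s < 6 → ∀ t : ℕ, t < 2 → (3 ^ r + 10 ^ s) % 13 = 0 →
      (3 ^ r + 10 ^ s) % 7 = 13 ^ t % 7 → s % 2 = 1 ∧ (r % 2 = 0 → t = 1) := by
    intro r hr s hs t ht
    interval_cases r <;> interval_cases s <;> interval_cases t <;> norm_num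
  obtain ⟨k1, k2⟩ := fin (x % 6) (Nat.mod_lt _ (by norm_num)) (y % 6) (Nat.mod_lt _ (by norm_num))
    (z % 2) (Nat.mod_lt _ (by norm_num)) h13 h7
  refine ⟨?_, by omega⟩
  by_contra hx
  have hx0 : x % 2 = 0 := by omega
  have hz1 := k2 (by omega)
  rw [hx0, hz1] at h8
  by_cases hy1 : y = 1
  · subst hy1; norm_num at h8
  · have : (8 : ℕ) ∣ 10 ^ y := (show (8 : ℕ) ∣ 10 ^ 3 by norm_num).trans (pow_dvd_pow _ (by omega))
    norm_num at h8
    omega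

theorem special (x y z : ℕ) (hx : 0 < x) (hy : 0 < y) (hz : 0 < z) (e : 3 ^ x + 10 ^ y = 13 ^ z) :
    y = 1 ∧ (x = 1 ∨ x = 7) := by
  obtain ⟨p1, p2⟩ := special_parity x y z hy hz e
  by_cases h : 1 = x ∧ 1 = y
  · omega
  · have := (pair_main 3 10 13 (by norm_num) (by norm_num) (by norm_num) (by decide) (by norm_num)
      (by norm_num) 1 1 1 x y z one_pos one_pos one_pos hx hy hz (by norm_num) e (by omega) (by omega) h).2
    omega

theorem three_main (a b c : ℕ) (ha : 2 ≤ a) (hb : 2 ≤ b) (hc : c.Prime) (hodd : Odd c) (hca : ¬ c ∣ a)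
    (hcb : ¬ c ∣ b) (x1 y1 z1 x2 y2 z2 x3 y3 z3 : ℕ) (hx1 : 0 < x1) (hy1 : 0 < y1) (hz1 : 0 < z1)
    (hx2 : 0 < x2) (hy2 : 0 < y2) (hz2 : 0 < z2) (hx3 : 0 < x3) (hy3 : 0 < y3) (hz3 : 0 < z3)
    (e1 : a ^ x1 + b ^ y1 = c ^ z1) (e2 : a ^ x2 + b ^ y2 = c ^ z2) (e3 : a ^ x3 + b ^ y3 = c ^ z3) :
    (x1 = x2 ∧ y1 = y2) ∨ (x1 = x3 ∧ y1 = y3) ∨ (x2 = x3 ∧ y2 = y3) := by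
  have fin : (c = 13 ∧ (a = 3 ∧ b = 10 ∨ a = 10 ∧ b = 3)) →
      (x1 = x2 ∧ y1 = y2) ∨ (x1 = x3 ∧ y1 = y3) ∨ (x2 = x3 ∧ y2 = y3) := by
    rintro ⟨rfl, ⟨rfl, rfl⟩ | ⟨rfl, rfl⟩⟩
    · have := special x1 y1 z1 hx1 hy1 hz1 e1
      have := special x2 y2 z2 hx2 hy2 hz2 e2
      have := special x3 y3 z3 hx3 hy3 hz3 e3
      omega
    · rw [add_comm] at e1 e2 e3
      have := special y1 x1 z1 hy1 hx1 hz1 e1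
      have := special y2 x2 z2 hy2 hx2 hz2 e2
      have := special y3 x3 z3 hy3 hx3 hz3 e3
      omega
  by_contra hcon
  have P := pair_main a b c ha hb hc hodd hca hcb
  apply hcon
  rcases parity_three a b c hc hodd hca hcb x1 y1 z1 x2 y2 z2 x3 y3 z3 hz1 hz2 hz3 e1 e2 e3 with h | h | h
  · have := P x1 y1 z1 x2 y2 z2 hx1 hy1 hz1 hx2 hy2 hz2 e1 e2 h.1 h.2 (fun h' => hcon (Or.inl h'))
    exact fin ⟨this.1, this.2.imp (fun q => ⟨q.1, q.2.1⟩) (fun q => ⟨q.1, q.2.1⟩)⟩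
  · have := P x1 y1 z1 x3 y3 z3 hx1 hy1 hz1 hx3 hy3 hz3 e1 e3 h.1 h.2 (fun h' => hcon (Or.inr (Or.inl h')))
    exact fin ⟨this.1, this.2.imp (fun q => ⟨q.1, q.2.1⟩) (fun q => ⟨q.1, q.2.1⟩)⟩
  · have := P x2 y2 z2 x3 y3 z3 hx2 hy2 hz2 hx3 hy3 hz3 e2 e3 h.1 h.2 (fun h' => hcon (Or.inr (Or.inr h')))
    exact fin ⟨this.1, this.2.imp (fun q => ⟨q.1, q.2.1⟩) (fun q => ⟨q.1, q.2.1⟩)⟩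

theorem growth (X k : ℕ) (hX : 3 ≤ X) (hk : 3 ≤ k) : (X + 1) * k < X ^ k + 1 := by
  induction k, hk using Nat.le_induction with
  | base => nlinarith [Nat.mul_le_mul hX hX, pow_succ X 2, sq X]
  | succ k hk ih =>
    rw [pow_succ]
    have h1 : (X + 1) * k ≤ X ^ k := by omega
    have h2 : X ^ k * 3 ≤ X ^ k * X := Nat.mul_le_mul_left _ hX
    have h3 : (X + 1) * 1 ≤ (X + 1) * k := Nat.mul_le_mul_left _ (by omega)
    rw [mul_add]
    omega

theorem odd_mult (B y1 : ℕ) (N : ℕ) (hB : 2 ≤ B) (hy1 : 0 < y1) (hN : 3 ≤ N) (e : B ^ y1 + 1 = N) :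
    ∀ y, N ∣ B ^ y + 1 → ∃ m, y = y1 * (2 * m + 1) := by
  intro y
  induction y using Nat.strong_induction_on with
  | _ y ih =>
  intro hd
  rcases lt_trichotomy y y1 with h | h | h
  · exfalso
    have h1 := Nat.le_of_dvd (by positivity) hd
    have h2 : B ^ y < B ^ y1 := Nat.pow_lt_pow_right (by omega) h
    omega
  · exact ⟨0, by omega⟩
  · obtain ⟨d, rfl⟩ := Nat.exists_eq_add_of_lt h
    have hB0 : 1 ≤ B ^ (d + 1) := Nat.one_le_pow _ _ (by omega)
    -- N ∣ B^(d+1) - 1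
    have h1 : (N : ℤ) ∣ (B : ℤ) ^ (d + 1) - 1 := by
      have h2 : (N : ℤ) ∣ (B : ℤ) ^ (y1 + d + 1) + 1 := by exact_mod_cast hd
      have h3 : (N : ℤ) = (B : ℤ) ^ y1 + 1 := by exact_mod_cast e.symm
      have h4 : (B : ℤ) ^ (d + 1) - 1 = (B : ℤ) ^ (d + 1) * N - ((B : ℤ) ^ (y1 + d + 1) + 1) := by
        rw [h3]; ring
      rw [h4]
      exact dvd_sub (dvd_mul_left _ _) h2
    rcases lt_or_ge (d + 1) y1 with h5 | h5
    · exfalso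
      have h6 : (2 : ℤ) ≤ (B : ℤ) ^ (d + 1) := by
        have : B ≤ B ^ (d + 1) := Nat.le_self_pow (by omega) B
        have : 2 ≤ B ^ (d + 1) := by omega
        exact_mod_cast this
      have h7 := Int.le_of_dvd (by omega) h1
      have h8 : B ^ (d + 1) < B ^ y1 := Nat.pow_lt_pow_right (by omega) h5
      have h9 : (B : ℤ) ^ (d + 1) < N := by
        have : B ^ (d + 1) < N := by omega
        exact_mod_cast this
      omega
    · obtain ⟨f, hf⟩ := Nat.exists_eq_add_of_le h5
      have h2 : N ∣ B ^ f + 1 := by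
        have h3 : (N : ℤ) = (B : ℤ) ^ y1 + 1 := by exact_mod_cast e.symm
        have h4 : (B : ℤ) ^ f + 1 = (B : ℤ) ^ f * N - ((B : ℤ) ^ (d + 1) - 1) := by
          rw [h3, hf]; ring
        have : (N : ℤ) ∣ (B : ℤ) ^ f + 1 := by
          rw [h4]; exact dvd_sub (dvd_mul_left _ _) h1
        exact_mod_cast this
      obtain ⟨m, hm⟩ := ih f (by omega) h2
      refine ⟨m + 1, ?_⟩
      have : y1 + d + 1 = 2 * y1 + f := by omega
      rw [this, hm]; ring

theorem one_pair (B c : ℕ) (hc : c.Prime) (hodd : Odd c) (hB : 2 ≤ B) (hcB : ¬ c ∣ B)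
    (y1 w1 y2 w2 : ℕ) (hy1 : 0 < y1) (hlt : y1 < y2) (hw1 : 0 < w1)
    (e1 : 1 + B ^ y1 = c ^ w1) (e2 : 1 + B ^ y2 = c ^ w2) : B ^ y1 = 2 := by
  have : Fact c.Prime := ⟨hc⟩
  have hc2 := hc.two_le
  have hX2 : 2 ≤ B ^ y1 := hB.trans (Nat.le_self_pow hy1.ne' B)
  have hlt' : c ^ w1 < c ^ w2 := by
    have : B ^ y1 < B ^ y2 := Nat.pow_lt_pow_right (by omega) hlt
    omega
  have hw : w1 < w2 := (Nat.pow_lt_pow_iff_right (by omega)).1 hlt'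
  obtain ⟨m, hm⟩ := odd_mult B y1 (c ^ w1) hB hy1 (by omega) (by omega) y2
    (by rw [add_comm, e2]; exact pow_dvd_pow _ hw.le)
  have hm0 : m ≠ 0 := by rintro rfl; omega
  by_contra hne
  have hg := growth (B ^ y1) (2 * m + 1) (by omega) (by omega)
  have hdX : c ∣ B ^ y1 + 1 := by rw [add_comm, e1]; exact dvd_pow_self _ hw1.ne'
  have hl := padicValNat.pow_add_pow hodd (x := B ^ y1) (y := 1) hdX
    (fun h => hcB (hc.dvd_of_dvd_pow h)) (odd_two_mul_add_one m)
  rw [one_pow, ← pow_mul, ← hm, add_comm, e2, add_comm _ 1, e1, padicValNat.prime_pow,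
    padicValNat.prime_pow] at hl
  have hle : c ^ padicValNat c (2 * m + 1) ≤ 2 * m + 1 :=
    Nat.le_of_dvd (by omega) pow_padicValNat_dvd
  have h1 : c ^ w2 = c ^ w1 * c ^ padicValNat c (2 * m + 1) := by rw [hl, pow_add]
  rw [← pow_mul, ← hm] at hg
  have h2 : c ^ w2 ≤ c ^ w1 * (2 * m + 1) := by rw [h1]; exact Nat.mul_le_mul_left _ hle
  rw [← e1, ← e2] at h2
  rw [add_comm 1 (B ^ y1)] at h2
  omega

theorem one_three (B c : ℕ) (hc : c.Prime) (hodd : Odd c) (hB : 0 < B) (hcB : ¬ c ∣ B)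
    (y1 w1 y2 w2 y3 w3 : ℕ) (hy1 : 0 < y1) (hy2 : 0 < y2) (hy3 : 0 < y3)
    (hw1 : 0 < w1) (hw2 : 0 < w2) (hw3 : 0 < w3)
    (e1 : 1 + B ^ y1 = c ^ w1) (e2 : 1 + B ^ y2 = c ^ w2) (e3 : 1 + B ^ y3 = c ^ w3) :
    y1 = y2 ∨ y1 = y3 ∨ y2 = y3 := by
  have hB2 : 2 ≤ B := by
    by_contra h
    obtain rfl : B = 1 := by omega
    have := hodd.pow (n := w1)
    rw [← e1, one_pow] at this
    exact absurd this (by decide)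
  have hinj : ∀ y y', B ^ y = 2 → B ^ y' = 2 → y = y' :=
    fun y y' h h' => Nat.pow_right_injective hB2 (h.trans h'.symm)
  have P := one_pair B c hc hodd hB2 hcB
  have chain : ∀ y w y' w' y'' w'' : ℕ, 0 < y → 0 < y' → 0 < w → 0 < w' → 1 + B ^ y = c ^ w →
      1 + B ^ y' = c ^ w' → 1 + B ^ y'' = c ^ w'' → ¬ (y < y' ∧ y' < y'') := by
    rintro y w y' w' y'' w'' hy hy' hw hw' f f' f'' ⟨l, l'⟩
    have := hinj y y' (P y w y' w' hy l hw f f') (P y' w' y'' w'' hy' l' hw' f' f'')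
    omega
  by_contra hcon
  have k1 := chain y1 w1 y2 w2 y3 w3 hy1 hy2 hw1 hw2 e1 e2 e3
  have k2 := chain y1 w1 y3 w3 y2 w2 hy1 hy3 hw1 hw3 e1 e3 e2
  have k3 := chain y2 w2 y1 w1 y3 w3 hy2 hy1 hw2 hw1 e2 e1 e3
  have k4 := chain y2 w2 y3 w3 y1 w1 hy2 hy3 hw2 hw3 e2 e3 e1
  have k5 := chain y3 w3 y1 w1 y2 w2 hy3 hy1 hw3 hw1 e3 e1 e2
  have k6 := chain y3 w3 y2 w2 y1 w1 hy3 hy2 hw3 hw2 e3 e2 e1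
  clear chain P hinj e1 e2 e3
  omega

theorem no_three (a b c : ℕ) (ha : 2 ≤ a) (hb : 2 ≤ b) (hc : c.Prime) (hodd : Odd c)
    (x1 y1 z1 x2 y2 z2 x3 y3 z3 : ℕ) (hx1 : 0 < x1) (hy1 : 0 < y1) (hz1 : 0 < z1)
    (hx2 : 0 < x2) (hy2 : 0 < y2) (hz2 : 0 < z2) (hx3 : 0 < x3) (hy3 : 0 < y3) (hz3 : 0 < z3)
    (e1 : a ^ x1 + b ^ y1 = c ^ z1) (e2 : a ^ x2 + b ^ y2 = c ^ z2) (e3 : a ^ x3 + b ^ y3 = c ^ z3) :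
    (x1 = x2 ∧ y1 = y2) ∨ (x1 = x3 ∧ y1 = y3) ∨ (x2 = x3 ∧ y2 = y3) := by
  have hcz : c ∣ a ^ x1 + b ^ y1 := e1 ▸ dvd_pow_self _ hz1.ne'
  have hiff : c ∣ a ↔ c ∣ b := by
    constructor
    · intro h
      exact hc.dvd_of_dvd_pow ((Nat.dvd_add_right (dvd_pow h hx1.ne')).1 hcz)
    · intro h
      exact hc.dvd_of_dvd_pow ((Nat.dvd_add_left (dvd_pow h hy1.ne')).1 hcz)
  by_cases hca : c ∣ a
  swap
  · exact three_main a b c ha hb hc hodd hca (fun h => hca (hiff.2 h)) x1 y1 z1 x2 y2 z2 x3 y3 z3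
      hx1 hy1 hz1 hx2 hy2 hz2 hx3 hy3 hz3 e1 e2 e3
  have hcb := hiff.1 hca
  obtain ⟨i, A, hA, rfl⟩ := Nat.exists_eq_pow_mul_and_not_dvd (show a ≠ 0 by omega) c hc.ne_one
  obtain ⟨j, B, hB, rfl⟩ := Nat.exists_eq_pow_mul_and_not_dvd (show b ≠ 0 by omega) c hc.ne_one
  have hi : i ≠ 0 := by rintro rfl; exact hA (by simpa using hca)
  have hj : j ≠ 0 := by rintro rfl; exact hB (by simpa using hcb)
  have hA0 : 0 < A := Nat.pos_of_ne_zero (by rintro rfl; exact hA (dvd_zero _))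
  have hB0 : 0 < B := Nat.pos_of_ne_zero (by rintro rfl; exact hB (dvd_zero _))
  -- unequal valuations are impossible
  have val : ∀ A B p q x y z d : ℕ, 0 < A → 0 < B → ¬ c ∣ A → q = p + d + 1 →
      c ^ p * A ^ x + c ^ q * B ^ y = c ^ z → False := by
    intro A B p q x y z d hA0 hB0 hA hq e
    subst hq
    have hpz : p ≤ z := by
      by_contra h
      have h1 : c ^ z < c ^ p := Nat.pow_lt_pow_right hc.one_lt (by omega)
      have h2 : 0 < A ^ x := by positivity
      have h3 : c ^ p ≤ c ^ p * A ^ x := Nat.le_mul_of_pos_right _ h2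
      have h4 : c ^ p * A ^ x ≤ c ^ z := e ▸ Nat.le_add_right _ _
      exact absurd (h3.trans h4) (not_le.2 h1)
    obtain ⟨w, rfl⟩ := Nat.exists_eq_add_of_le hpz
    have hcp : 0 < c ^ p := Nat.pow_pos hc.pos
    have e' : A ^ x + c * (c ^ d * B ^ y) = c ^ w := by
      apply Nat.eq_of_mul_eq_mul_left hcp
      rw [← pow_add, ← e]; ring
    have h1 : 0 < A ^ x := by positivity
    have h2 : 0 < c ^ d * B ^ y := Nat.mul_pos (Nat.pow_pos hc.pos) (by positivity)
    by_cases hw : w = 0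
    · subst hw
      have := hc.two_le
      rw [pow_zero] at e'
      nlinarith
    · have h3 : c ∣ A ^ x + c * (c ^ d * B ^ y) := e' ▸ dvd_pow_self _ hw
      exact hA (hc.dvd_of_dvd_pow ((Nat.dvd_add_left (dvd_mul_right _ _)).1 h3))
  have red : ∀ x y z : ℕ, (c ^ i * A) ^ x + (c ^ j * B) ^ y = c ^ z →
      i * x = j * y ∧ ∃ w, 0 < w ∧ A ^ x + B ^ y = c ^ w := by
    intro x y z e
    rw [mul_pow, mul_pow, ← pow_mul, ← pow_mul] at e
    have hxy : i * x = j * y := by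
      rcases lt_trichotomy (i * x) (j * y) with h | h | h
      · obtain ⟨d, hd⟩ := Nat.exists_eq_add_of_lt h
        exact (val A B _ _ x y z d hA0 hB0 hA hd e).elim
      · exact h
      · obtain ⟨d, hd⟩ := Nat.exists_eq_add_of_lt h
        rw [add_comm] at e
        exact (val B A _ _ y x z d hB0 hA0 hB hd e).elim
    refine ⟨hxy, ?_⟩
    rw [← hxy, ← mul_add] at e
    obtain ⟨w, -, hw⟩ := (Nat.dvd_prime_pow hc).1 (Dvd.intro_left _ e)
    refine ⟨w, ?_, hw⟩
    rcases Nat.eq_zero_or_pos w with rfl | h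
    · have h1 : 0 < A ^ x := by positivity
      have h2 : 0 < B ^ y := by positivity
      rw [pow_zero] at hw
      omega
    · exact h
  obtain ⟨v1, w1, hw1, f1⟩ := red _ _ _ e1
  obtain ⟨v2, w2, hw2, f2⟩ := red _ _ _ e2
  obtain ⟨v3, w3, hw3, f3⟩ := red _ _ _ e3
  have hxx : ∀ x y x' y', i * x = j * y → i * x' = j * y' → y = y' → x = x' := by
    intro x y x' y' h h' hyy
    subst hyy
    exact Nat.eq_of_mul_eq_mul_left (Nat.pos_of_ne_zero hi) (h.trans h'.symm)
  have hyy : ∀ x y x' y', i * x = j * y → i * x' = j * y' → x = x' → y = y' := by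
    intro x y x' y' h h' hxx
    subst hxx
    exact Nat.eq_of_mul_eq_mul_left (Nat.pos_of_ne_zero hj) (h.symm.trans h')
  by_cases hA1 : A = 1
  · subst hA1
    rw [one_pow] at f1 f2 f3
    rcases one_three B c hc hodd hB0 hB y1 w1 y2 w2 y3 w3 hy1 hy2 hy3 hw1 hw2 hw3 f1 f2 f3 with h | h | h
    · exact Or.inl ⟨hxx _ _ _ _ v1 v2 h, h⟩
    · exact Or.inr (Or.inl ⟨hxx _ _ _ _ v1 v3 h, h⟩)
    · exact Or.inr (Or.inr ⟨hxx _ _ _ _ v2 v3 h, h⟩)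
  by_cases hB1 : B = 1
  · subst hB1
    rw [one_pow, add_comm] at f1 f2 f3
    rcases one_three A c hc hodd hA0 hA x1 w1 x2 w2 x3 w3 hx1 hx2 hx3 hw1 hw2 hw3 f1 f2 f3 with h | h | h
    · exact Or.inl ⟨h, hyy _ _ _ _ v1 v2 h⟩
    · exact Or.inr (Or.inl ⟨h, hyy _ _ _ _ v1 v3 h⟩)
    · exact Or.inr (Or.inr ⟨h, hyy _ _ _ _ v2 v3 h⟩)
  exact three_main A B c (by omega) (by omega) hc hodd hA hB x1 y1 w1 x2 y2 w2 x3 y3 w3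
      hx1 hy1 hw1 hx2 hy2 hw2 hx3 hy3 hw3 f1 f2 f3

theorem stmt7 (a b c : ℕ) (ha : 0 < a) (hb : 0 < b) (hc : c.Prime) (hodd : Odd c) :
    Set.ncard {p : ℕ × ℕ × ℕ | 0 < p.1 ∧ 0 < p.2.1 ∧ 0 < p.2.2 ∧
      a ^ p.1 + b ^ p.2.1 = c ^ p.2.2} ≤ 2 := by
  by_contra hcon
  rw [not_le] at hcon
  have hfin := Set.finite_of_ncard_pos (lt_trans (by norm_num : 0 < 2) hcon)
  obtain ⟨⟨x1, y1, z1⟩, ⟨x2, y2, z2⟩, ⟨x3, y3, z3⟩, m1, m2, m3, n12, n13, n23⟩ :=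
    (Set.two_lt_ncard_iff hfin).1 hcon
  obtain ⟨hx1, hy1, hz1, e1⟩ := m1
  obtain ⟨hx2, hy2, hz2, e2⟩ := m2
  obtain ⟨hx3, hy3, hz3, e3⟩ := m3
  dsimp only at hx1 hy1 hz1 e1 hx2 hy2 hz2 e2 hx3 hy3 hz3 e3
  -- if `a = 1` or `b = 1`, the solution set is infinite as soon as it is nonempty
  have ha2 : 2 ≤ a := by
    by_contra h
    obtain rfl : a = 1 := by omega
    refine Set.infinite_of_injective_forall_mem (f := fun n : ℕ => ((n + 1, y1, z1) : ℕ × ℕ × ℕ))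
      ?_ ?_ hfin
    · intro m n h; simpa using h
    · intro n
      exact ⟨Nat.succ_pos n, hy1, hz1, by simpa using e1⟩
  have hb2 : 2 ≤ b := by
    by_contra h
    obtain rfl : b = 1 := by omega
    refine Set.infinite_of_injective_forall_mem (f := fun n : ℕ => ((x1, n + 1, z1) : ℕ × ℕ × ℕ))
      ?_ ?_ hfin
    · intro m n h; simpa using h
    · intro n
      exact ⟨hx1, Nat.succ_pos n, hz1, by simpa using e1⟩
  have hzz : ∀ x y z x' y' z', a ^ x + b ^ y = c ^ z → a ^ x' + b ^ y' = c ^ z' → x = x' ∧ y = y' →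
      (x, y, z) = (x', y', z') := by
    rintro x y z x' y' z' h h' ⟨rfl, rfl⟩
    rw [Nat.pow_right_injective hc.two_le (h.symm.trans h')]
  rcases no_three a b c ha2 hb2 hc hodd x1 y1 z1 x2 y2 z2 x3 y3 z3 hx1 hy1 hz1 hx2 hy2 hz2 hx3 hy3 hz3
    e1 e2 e3 with h | h | h
  · exact n12 (hzz _ _ _ _ _ _ e1 e2 h)
  · exact n13 (hzz _ _ _ _ _ _ e1 e3 h)
  · exact n23 (hzz _ _ _ _ _ _ e2 e3 h)
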